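/- Let {Ã_x} be a finite set of d×d real symmetric orthogonal matrices. Define recursively V_0 := span_ℝ({I} ∪ {Ã_x : x}) and V_j := span_ℝ(sgn(V_{j−1})) for j ≥ 1. Then for every j ≥ 0: if x ∈ V_j, then p(x) ∈ V_{j+1} for every polynomial p with real coefficients; consequently, if x, y ∈ V_j then xy + yx ∈ V_{j+1}. -/

import Mathlib

open scoped BigOperators Matrix

noncomputable section

namespace SelfTest

/-- The sign map on real symmetric matrices via the spectral decomposition:
`sgn(∑ λⱼ uⱼuⱼᵀ) = ∑ sgn(λⱼ) uⱼuⱼᵀ` (and junk value `0` off the symmetric matrices). -/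
def msgn {d : ℕ} (H : Matrix (Fin d) (Fin d) ℝ) : Matrix (Fin d) (Fin d) ℝ :=
  if h : H.IsHermitian then
    (h.eigenvectorUnitary : Matrix (Fin d) (Fin d) ℝ) *
      Matrix.diagonal (fun i => Real.sign (h.eigenvalues i)) *
      (star (h.eigenvectorUnitary : Matrix (Fin d) (Fin d) ℝ))
  else 0

end SelfTest

namespace SelfTest

/-- The iterated subspaces `V_0 = span S`, `V_{j+1} = span (sgn(V_j))`. -/
def Vseq {d : ℕ} (S : Set (Matrix (Fin d) (Fin d) ℝ)) :
    ℕ → Submodule ℝ (Matrix (Fin d) (Fin d) ℝ)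
  | 0 => Submodule.span ℝ S
  | j + 1 => Submodule.span ℝ (msgn '' (Vseq S j : Set (Matrix (Fin d) (Fin d) ℝ)))

/-- The real Jordan algebra generated by a set `S` of symmetric matrices: the smallest
linear subspace containing `S ∪ {I}` and closed under the Jordan product
`a ∘ b = (ab + ba)/2`. -/
def JAgen {d : ℕ} (S : Set (Matrix (Fin d) (Fin d) ℝ)) :
    Submodule ℝ (Matrix (Fin d) (Fin d) ℝ) :=
  sInf {W | S ⊆ (W : Set (Matrix (Fin d) (Fin d) ℝ)) ∧
    (1 : Matrix (Fin d) (Fin d) ℝ) ∈ W ∧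
    ∀ a ∈ W, ∀ b ∈ W, (1 / 2 : ℝ) • (a * b + b * a) ∈ W}

/-- The iterated Jordan-product spans: `W_0 = span S`,
`W_{j+1} = span {a ∘ b : a, b ∈ W_j}`. -/
def Wseq {d : ℕ} (S : Set (Matrix (Fin d) (Fin d) ℝ)) :
    ℕ → Submodule ℝ (Matrix (Fin d) (Fin d) ℝ)
  | 0 => Submodule.span ℝ S
  | j + 1 => Submodule.span ℝ
      {m | ∃ a ∈ Wseq S j, ∃ b ∈ Wseq S j, m = (1 / 2 : ℝ) • (a * b + b * a)}

end SelfTest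

open SelfTest

/-- The matrix sign map is the continuous functional calculus of `Real.sign`. -/
lemma msgn_eq_cfc {d : ℕ} {H : Matrix (Fin d) (Fin d) ℝ} (hH : H.IsHermitian) :
    msgn H = cfc Real.sign H := by
  rw [hH.cfc_eq, msgn, dif_pos hH, Matrix.IsHermitian.cfc, Unitary.conjStarAlgAut_apply]
  rfl

/-- Values of the sign map are Hermitian. -/
lemma isHermitian_msgn {d : ℕ} (H : Matrix (Fin d) (Fin d) ℝ) : (msgn H).IsHermitian := by
  by_cases hH : H.IsHermitian
  · rw [msgn_eq_cfc hH]
    exact (cfc_predicate Real.sign H : IsSelfAdjoint _)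
  · rw [msgn, dif_neg hH]
    exact Matrix.isHermitian_zero

/-- A linear span of Hermitian matrices consists of Hermitian matrices. -/
lemma isHermitian_of_mem_span {d : ℕ} {S : Set (Matrix (Fin d) (Fin d) ℝ)}
    (hS : ∀ M ∈ S, M.IsHermitian) {x : Matrix (Fin d) (Fin d) ℝ}
    (hx : x ∈ Submodule.span ℝ S) : x.IsHermitian := by
  induction hx using Submodule.span_induction with
  | mem x hx => exact hS x hx
  | zero => exact Matrix.isHermitian_zero
  | add x y _ _ hx hy => exact hx.add hy
  | smul c x _ hx => exact hx.smul (IsSelfAdjoint.all c)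

lemma isHermitian_of_mem_Vseq {d : ℕ} {S : Set (Matrix (Fin d) (Fin d) ℝ)}
    (hS : ∀ M ∈ S, M.IsHermitian) (j : ℕ) {x : Matrix (Fin d) (Fin d) ℝ}
    (hx : x ∈ Vseq S j) : x.IsHermitian := by
  cases j with
  | zero => exact isHermitian_of_mem_span hS hx
  | succ j =>
    refine isHermitian_of_mem_span (S := msgn '' (Vseq S j : Set (Matrix (Fin d) (Fin d) ℝ))) ?_ hx
    rintro _ ⟨H, -, rfl⟩
    exact isHermitian_msgn H

lemma msgn_mem_Vseq_succ {d : ℕ} {S : Set (Matrix (Fin d) (Fin d) ℝ)} {j : ℕ}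
    {x : Matrix (Fin d) (Fin d) ℝ} (hx : x ∈ Vseq S j) : msgn x ∈ Vseq S (j + 1) :=
  Submodule.subset_span ⟨x, hx, rfl⟩

lemma one_mem_Vseq {d : ℕ} {S : Set (Matrix (Fin d) (Fin d) ℝ)}
    (hS : (1 : Matrix (Fin d) (Fin d) ℝ) ∈ S) (j : ℕ) :
    (1 : Matrix (Fin d) (Fin d) ℝ) ∈ Vseq S j := by
  induction j with
  | zero => exact Submodule.subset_span hS
  | succ j ih =>
    have h := msgn_mem_Vseq_succ ih
    rwa [msgn_eq_cfc Matrix.isHermitian_one, cfc_apply_one, Real.sign_one, map_one] at h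

lemma continuousOn_spectrum {d : ℕ} (x : Matrix (Fin d) (Fin d) ℝ) (f : ℝ → ℝ) :
    ContinuousOn f (spectrum ℝ x) :=
  x.finite_real_spectrum.continuousOn f

/-- The sign of a shifted Hermitian matrix, as a function of the matrix. -/
lemma msgn_sub_smul_one {d : ℕ} {x : Matrix (Fin d) (Fin d) ℝ} (hx : x.IsHermitian) (c : ℝ) :
    msgn (x - c • 1) = cfc (fun t => Real.sign (t - c)) x := by
  have hsa : IsSelfAdjoint x := hx
  have hshift : cfc (fun t : ℝ => t - c) x = x - c • 1 := by
    rw [cfc_sub (fun t : ℝ => t) (fun _ => c) x, cfc_id' ℝ x, cfc_const c x,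
      Algebra.algebraMap_eq_smul_one]
  have hherm : (x - c • 1).IsHermitian := by
    rw [← hshift]
    exact (cfc_predicate (fun t : ℝ => t - c) x : IsSelfAdjoint _)
  rw [msgn_eq_cfc hherm, ← hshift, ← cfc_comp' Real.sign (fun t => t - c) x
    ((x.finite_real_spectrum.image _).continuousOn _)]

/-- On a finite set, the indicator of a point is half a difference of shifted sign functions. -/
lemma exists_sign_sub_sign_eqOn {s : Set ℝ} (hs : s.Finite) (a : ℝ) :
    ∃ b c : ℝ, s.EqOn (fun t => (1 / 2) * (Real.sign (t - b) - Real.sign (t - c)))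
      (fun t => if t = a then 1 else 0) := by
  have hmem : (s \ {a})ᶜ ∈ nhds a := hs.sdiff.isClosed.isOpen_compl.mem_nhds (by simp)
  obtain ⟨ε, hε, hball⟩ := Metric.mem_nhds_iff.1 hmem
  refine ⟨a - ε / 2, a + ε / 2, fun t ht => ?_⟩
  dsimp only
  split_ifs with hta
  · rw [Real.sign_of_pos (by linarith), Real.sign_of_neg (by linarith)]
    norm_num
  · have hdist : ε ≤ |t - a| := by
      by_contra! hlt
      exact hball (show t ∈ Metric.ball a ε by rwa [Metric.mem_ball, Real.dist_eq]) ⟨ht, hta⟩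
    rcases le_abs.1 hdist with h | h
    · rw [Real.sign_of_pos (by linarith), Real.sign_of_pos (by linarith)]
      norm_num
    · rw [Real.sign_of_neg (by linarith), Real.sign_of_neg (by linarith)]
      norm_num

/-- Every function of a Hermitian matrix in `V_j` lies in `V_{j+1}`. -/
lemma cfc_mem_Vseq_succ {d : ℕ} {S : Set (Matrix (Fin d) (Fin d) ℝ)}
    (hS : ∀ M ∈ S, M.IsHermitian) (h1 : (1 : Matrix (Fin d) (Fin d) ℝ) ∈ S) {j : ℕ}
    {x : Matrix (Fin d) (Fin d) ℝ} (hx : x ∈ Vseq S j) (f : ℝ → ℝ) :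
    cfc f x ∈ Vseq S (j + 1) := by
  have hherm := isHermitian_of_mem_Vseq hS j hx
  have hsign (c : ℝ) : cfc (fun t => Real.sign (t - c)) x ∈ Vseq S (j + 1) := by
    rw [← msgn_sub_smul_one hherm c]
    exact msgn_mem_Vseq_succ (sub_mem hx (Submodule.smul_mem _ c (one_mem_Vseq h1 j)))
  have hproj (a : ℝ) : cfc (fun t => if t = a then (1 : ℝ) else 0) x ∈ Vseq S (j + 1) := by
    obtain ⟨b, c, hbc⟩ := exists_sign_sub_sign_eqOn x.finite_real_spectrum a
    rw [← cfc_congr hbc, cfc_const_mul _ _ x (continuousOn_spectrum x _),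
      cfc_sub _ _ x (continuousOn_spectrum x _) (continuousOn_spectrum x _)]
    exact Submodule.smul_mem _ _ (sub_mem (hsign b) (hsign c))
  have hf : (spectrum ℝ x).EqOn f
      (∑ a ∈ x.finite_real_spectrum.toFinset, fun t => f a * if t = a then (1 : ℝ) else 0) := by
    intro t ht
    simp only [Finset.sum_apply, mul_ite, mul_one, mul_zero]
    rw [Finset.sum_ite_eq, if_pos (x.finite_real_spectrum.mem_toFinset.2 ht)]
  rw [cfc_congr hf, cfc_sum _ _ _ fun _ _ => continuousOn_spectrum x _]
  refine sum_mem fun a _ => ?_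
  rw [cfc_const_mul _ _ x (continuousOn_spectrum x _)]
  exact Submodule.smul_mem _ _ (hproj a)

/-- Every polynomial in a matrix of `V_j` lies in `V_{j+1}`. -/
lemma aeval_mem_Vseq_succ {d : ℕ} {S : Set (Matrix (Fin d) (Fin d) ℝ)}
    (hS : ∀ M ∈ S, M.IsHermitian) (h1 : (1 : Matrix (Fin d) (Fin d) ℝ) ∈ S) {j : ℕ}
    {x : Matrix (Fin d) (Fin d) ℝ} (hx : x ∈ Vseq S j) (p : Polynomial ℝ) :
    Polynomial.aeval x p ∈ Vseq S (j + 1) := by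
  have hsa : IsSelfAdjoint x := isHermitian_of_mem_Vseq hS j hx
  rw [← cfc_polynomial p x]
  exact cfc_mem_Vseq_succ hS h1 hx p.eval

/-- the iterated sgn-spans are closed under polynomial functional
calculus one step later (Lemma `xinpxin`). -/
theorem stmt_14 {d : ℕ} (A : Finset (Matrix (Fin d) (Fin d) ℝ))
    (hA : ∀ M ∈ A, M.IsSymm ∧ M * M = 1) :
    ∀ j : ℕ,
      (∀ x ∈ Vseq ({1} ∪ (A : Set (Matrix (Fin d) (Fin d) ℝ))) j,
        ∀ p : Polynomial ℝ,
          Polynomial.aeval x p ∈ Vseq ({1} ∪ (A : Set (Matrix (Fin d) (Fin d) ℝ))) (j + 1)) ∧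
      (∀ x ∈ Vseq ({1} ∪ (A : Set (Matrix (Fin d) (Fin d) ℝ))) j,
        ∀ y ∈ Vseq ({1} ∪ (A : Set (Matrix (Fin d) (Fin d) ℝ))) j,
          x * y + y * x ∈ Vseq ({1} ∪ (A : Set (Matrix (Fin d) (Fin d) ℝ))) (j + 1)) := by
  have hS : ∀ M ∈ ({1} ∪ (A : Set (Matrix (Fin d) (Fin d) ℝ))), M.IsHermitian := by
    rintro M (rfl | hM)
    · exact Matrix.isHermitian_one
    · exact (Matrix.conjTranspose_eq_transpose_of_trivial M).trans (hA M hM).1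
  have h1 : (1 : Matrix (Fin d) (Fin d) ℝ) ∈ ({1} ∪ (A : Set (Matrix (Fin d) (Fin d) ℝ))) :=
    Or.inl rfl
  refine fun j => ⟨fun x hx p => aeval_mem_Vseq_succ hS h1 hx p, fun x hx y hy => ?_⟩
  have hsq (z : Matrix (Fin d) (Fin d) ℝ)
      (hz : z ∈ Vseq ({1} ∪ (A : Set (Matrix (Fin d) (Fin d) ℝ))) j) :
      z * z ∈ Vseq ({1} ∪ (A : Set (Matrix (Fin d) (Fin d) ℝ))) (j + 1) := by
    have h := aeval_mem_Vseq_succ hS h1 hz (Polynomial.X ^ 2)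
    rwa [Polynomial.aeval_X_pow, pow_two] at h
  have h := sub_mem (sub_mem (hsq _ (add_mem hx hy)) (hsq x hx)) (hsq y hy)
  have hpol : x * y + y * x = (x + y) * (x + y) - x * x - y * y := by noncomm_ring
  rwa [hpol]
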